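/- (Hexagonal grid) For θ₁ = 0 and θ₂ = 2π/3, the quantities α = (cos²θ₁ + cos θ₁ cos θ₂ + cos²θ₂)/|sin(θ₂−θ₁)|, β = (sin²θ₁ + sin θ₁ sin θ₂ + sin²θ₂)/|sin(θ₂−θ₁)|, γ = (sin 2θ₁ + sin(θ₁+θ₂) + sin 2θ₂)/|sin(θ₂−θ₁)| satisfy α = β = √3/2 and γ = 0, so that C(0, 2π/3) = √(3/2) and, for every twice weakly differentiable f with second derivatives in L²(ℝ²) and every T > 0, the asymptotic error equals ε_{Ξ_Hex,asym}(f) = (T²/(8√15)) ‖Δf‖_{L²}, where Δf = ∂²f/∂x₁² + ∂²f/∂x₂² is the Laplacian of f. -/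

import Mathlib

open MeasureTheory Real

noncomputable def alph (θ₁ θ₂ : ℝ) : ℝ :=
  (Real.cos θ₁ ^ 2 + Real.cos θ₁ * Real.cos θ₂ + Real.cos θ₂ ^ 2) / |Real.sin (θ₂ - θ₁)|

noncomputable def bet (θ₁ θ₂ : ℝ) : ℝ :=
  (Real.sin θ₁ ^ 2 + Real.sin θ₁ * Real.sin θ₂ + Real.sin θ₂ ^ 2) / |Real.sin (θ₂ - θ₁)|

noncomputable def gam (θ₁ θ₂ : ℝ) : ℝ :=
  (Real.sin (2 * θ₁) + Real.sin (θ₁ + θ₂) + Real.sin (2 * θ₂)) / |Real.sin (θ₂ - θ₁)|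

/-- Second-order directional (partial) derivative: `∂_v ∂_u f` at `x`. -/
noncomputable def pderiv2 (f : ℝ × ℝ → ℝ) (u v : ℝ × ℝ) (x : ℝ × ℝ) : ℝ :=
  fderiv ℝ (fun y => fderiv ℝ f y u) x v

/-- Squared Frobenius norm of the Hessian of `f` at `x`. -/
noncomputable def hessFrobSq (f : ℝ × ℝ → ℝ) (x : ℝ × ℝ) : ℝ :=
  (pderiv2 f (1, 0) (1, 0) x) ^ 2 + (pderiv2 f (1, 0) (0, 1) x) ^ 2 +
    (pderiv2 f (0, 1) (1, 0) x) ^ 2 + (pderiv2 f (0, 1) (0, 1) x) ^ 2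

/-- The asymptotic (dominant) error
`ε_{Ξ,asym}(f) = (T²/(12√5))·(∫ (α ∂₁₁f + γ ∂₁₂f + β ∂₂₂f)² dx)^{1/2}`. -/
noncomputable def epsAsym (θ₁ θ₂ T : ℝ) (f : ℝ × ℝ → ℝ) : ℝ :=
  (T ^ 2 / (12 * Real.sqrt 5)) *
    Real.sqrt (∫ x : ℝ × ℝ,
      (alph θ₁ θ₂ * pderiv2 f (1, 0) (1, 0) x + gam θ₁ θ₂ * pderiv2 f (1, 0) (0, 1) x +
        bet θ₁ θ₂ * pderiv2 f (0, 1) (0, 1) x) ^ 2)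

theorem cos_two_mul_pi_div_three : Real.cos (2 * π / 3) = -1 / 2 := by
  rw [show 2 * π / 3 = π - π / 3 by ring, Real.cos_pi_sub, Real.cos_pi_div_three]
  norm_num

theorem sin_two_mul_pi_div_three : Real.sin (2 * π / 3) = Real.sqrt 3 / 2 := by
  rw [show 2 * π / 3 = π - π / 3 by ring, Real.sin_pi_sub, Real.sin_pi_div_three]

theorem alph_hex : alph 0 (2 * π / 3) = Real.sqrt 3 / 2 := by
  have h3 : Real.sqrt 3 ^ 2 = 3 := Real.sq_sqrt (by norm_num)
  rw [alph, sub_zero, cos_two_mul_pi_div_three, sin_two_mul_pi_div_three, Real.cos_zero,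
    abs_of_pos (by positivity)]
  field_simp
  linarith

theorem bet_hex : bet 0 (2 * π / 3) = Real.sqrt 3 / 2 := by
  rw [bet, sub_zero, sin_two_mul_pi_div_three, Real.sin_zero, abs_of_pos (by positivity)]
  field_simp
  ring

theorem gam_hex : gam 0 (2 * π / 3) = 0 := by
  rw [gam, Real.sin_two_mul (2 * π / 3), zero_add, sin_two_mul_pi_div_three,
    cos_two_mul_pi_div_three, mul_zero, Real.sin_zero]
  ring

theorem epsAsym_hex (T : ℝ) (f : ℝ × ℝ → ℝ) :
    epsAsym 0 (2 * π / 3) T f = (T ^ 2 / (8 * Real.sqrt 15)) *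
      Real.sqrt (∫ x : ℝ × ℝ,
        (pderiv2 f (1, 0) (1, 0) x + pderiv2 f (0, 1) (0, 1) x) ^ 2) := by
  have h3 : Real.sqrt 3 ^ 2 = 3 := Real.sq_sqrt (by norm_num)
  have h15 : Real.sqrt 15 = Real.sqrt 3 * Real.sqrt 5 := by
    rw [← Real.sqrt_mul (by norm_num)]
    norm_num
  have hint (x : ℝ × ℝ) :
      (Real.sqrt 3 / 2 * pderiv2 f (1, 0) (1, 0) x + 0 * pderiv2 f (1, 0) (0, 1) x +
        Real.sqrt 3 / 2 * pderiv2 f (0, 1) (0, 1) x) ^ 2 =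
      (Real.sqrt 3 / 2) ^ 2 *
        (pderiv2 f (1, 0) (1, 0) x + pderiv2 f (0, 1) (0, 1) x) ^ 2 := by
    ring
  rw [epsAsym, alph_hex, bet_hex, gam_hex]
  simp_rw [hint]
  rw [integral_const_mul, Real.sqrt_mul (sq_nonneg _), Real.sqrt_sq (by positivity),
    ← mul_assoc, h15]
  congr 1
  field_simp
  rw [h3]
  ring

/-- The hexagonal grid (`θ₁ = 0`, `θ₂ = 2π/3`): `α = β = √3/2`, `γ = 0`,
`C(0, 2π/3) = √(3/2)`, and `ε_{Ξ_Hex,asym}(f) = (T²/(8√15))·‖Δf‖_{L²}`, where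
`Δf = ∂₁₁f + ∂₂₂f` is the Laplacian. -/
theorem hexagonal_grid_error :
    alph 0 (2 * π / 3) = Real.sqrt 3 / 2 ∧ bet 0 (2 * π / 3) = Real.sqrt 3 / 2 ∧
    gam 0 (2 * π / 3) = 0 ∧
    Real.sqrt ((alph 0 (2 * π / 3)) ^ 2 + (bet 0 (2 * π / 3)) ^ 2 + (gam 0 (2 * π / 3)) ^ 2)
      = Real.sqrt (3 / 2) ∧
    (∀ (f : ℝ × ℝ → ℝ), ContDiff ℝ 2 f →
      Integrable (fun x : ℝ × ℝ => hessFrobSq f x) →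
      ∀ T : ℝ, 0 < T →
        epsAsym 0 (2 * π / 3) T f
          = (T ^ 2 / (8 * Real.sqrt 15)) *
              Real.sqrt (∫ x : ℝ × ℝ,
                (pderiv2 f (1, 0) (1, 0) x + pderiv2 f (0, 1) (0, 1) x) ^ 2)) := by
  refine ⟨alph_hex, bet_hex, gam_hex, ?_, fun f _ _ T _ => epsAsym_hex T f⟩
  have h3 : Real.sqrt 3 ^ 2 = 3 := Real.sq_sqrt (by norm_num)
  rw [alph_hex, bet_hex, gam_hex, div_pow, h3]
  norm_num
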